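/- arXiv:2503.20773 — 2 statements merged into one kernel-verified Lean document; each statement's English description precedes it below -/
import Mathlib

section
/- Let $d = 3$. Then: $|S_{(0,0,0)}| = |GL_3(\mathbb{F}_q)| = (q-1)^3 q^3 (q+1)(q^2+q+1)$; for every integer $n \ge 1$, $|S_{(n,n,0)}| = |S_{(n,0,0)}| = (q-1)^3 (q+1) q^{2n+3}$; and for all integers $n_1 > n_2 \ge 1$, $|S_{(n_1,n_2,0)}| = (q-1)^3 q^{2n_1+3}$. -/
open Matrix Polynomial

noncomputable section

/-- `t = X⁻¹` in the Laurent series field `F = 𝔽_q((X))`. -/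
def tF (Fq : Type) [Field Fq] : LaurentSeries Fq := HahnSeries.single (-1 : ℤ) (1 : Fq)

/-- The embedding of the polynomial ring `𝔽_q[t]` into `F = 𝔽_q((X))`, sending the
polynomial variable to `t = X⁻¹`. -/
def polyToF (Fq : Type) [Field Fq] : Polynomial Fq →+* LaurentSeries Fq :=
  Polynomial.eval₂RingHom (HahnSeries.C) (tF Fq)

/-- The lattice `l_n̄ = t^{n₁}𝒪e₁ ⊕ ⋯ ⊕ t^{n_d}𝒪e_d` as an `𝒪`-submodule of `F^d`,
where `𝒪 = 𝔽_q[[X]]` acts on `F = 𝔽_q((X))` via the inclusion, and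
`t^{n} = HahnSeries.single (-n) 1`. -/
def lattM (Fq : Type) [Field Fq] {d : ℕ} (n : Fin d → ℤ) :
    Submodule (PowerSeries Fq) (Fin d → LaurentSeries Fq) :=
  Submodule.span (PowerSeries Fq)
    (Set.range fun i : Fin d =>
      (HahnSeries.single (-(n i)) (1 : Fq) : LaurentSeries Fq) •
        (Pi.single i (1 : LaurentSeries Fq) : Fin d → LaurentSeries Fq))

/-- The image `g L` of an `𝒪`-submodule `L ⊆ F^d` under a matrix `g ∈ M_d(F)`. -/
def actM (Fq : Type) [Field Fq] {d : ℕ} (g : Matrix (Fin d) (Fin d) (LaurentSeries Fq))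
    (L : Submodule (PowerSeries Fq) (Fin d → LaurentSeries Fq)) :
    Submodule (PowerSeries Fq) (Fin d → LaurentSeries Fq) :=
  L.map ((g.mulVecLin).restrictScalars (PowerSeries Fq))

/-- The image `a L` of an `𝒪`-submodule `L ⊆ F^d` under scalar multiplication by `a ∈ F`. -/
def scaleM (Fq : Type) [Field Fq] {d : ℕ} (a : LaurentSeries Fq)
    (L : Submodule (PowerSeries Fq) (Fin d → LaurentSeries Fq)) :
    Submodule (PowerSeries Fq) (Fin d → LaurentSeries Fq) :=
  L.map ((LinearMap.lsmul (LaurentSeries Fq) (Fin d → LaurentSeries Fq) a).restrictScalars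
    (PowerSeries Fq))

/-- The image in `M_d(F)` of a matrix over `𝔽_q[t]`. -/
def glToF (Fq : Type) [Field Fq] {d : ℕ} (γ : GL (Fin d) (Polynomial Fq)) :
    Matrix (Fin d) (Fin d) (LaurentSeries Fq) :=
  (γ : Matrix (Fin d) (Fin d) (Polynomial Fq)).map (polyToF Fq)

/-- The stabilizer `S_n̄ = {γ ∈ GL_d(𝔽_q[t]) : γ l_n̄ = l_n̄}`. -/
def Stab (Fq : Type) [Field Fq] {d : ℕ} (n : Fin d → ℤ) :
    Set (GL (Fin d) (Polynomial Fq)) :=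
  {γ | actM Fq (glToF Fq γ) (lattM Fq n) = lattM Fq n}

/-- `N_T^d`: integer tuples `n₁ ≥ n₂ ≥ ⋯ ≥ n_d = 0`. -/
def NT {d : ℕ} (n : Fin d → ℤ) : Prop :=
  (∀ i j : Fin d, i ≤ j → n j ≤ n i) ∧ ∀ i : Fin d, (i : ℕ) = d - 1 → n i = 0

/-- The difference sequence `m_i = n_i - n_{i+1}`. -/
def mdiff {d : ℕ} (n : Fin d → ℤ) (i : ℕ) (h : i + 1 < d) : ℤ :=
  n ⟨i, Nat.lt_of_succ_lt h⟩ - n ⟨i + 1, h⟩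

end

theorem tF_pow (Fq : Type) [Field Fq] (k : ℕ) :
    tF Fq ^ k = HahnSeries.single (-(k : ℤ)) (1 : Fq) := by
  simp [tF, HahnSeries.single_pow]

theorem coeff_polyToF (Fq : Type) [Field Fq] (p : Polynomial Fq) (k : ℤ) :
    (polyToF Fq p).coeff k = if k ≤ 0 then p.coeff k.natAbs else 0 := by
  induction p using Polynomial.induction_on' with
  | add p r hp hr => simp only [map_add, HahnSeries.coeff_add, hp, hr]; split_ifs <;> simp
  | monomial m a =>
    simp only [polyToF, Polynomial.coe_eval₂RingHom, Polynomial.eval₂_monomial, tF_pow,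
      HahnSeries.C_apply, HahnSeries.single_mul_single, HahnSeries.coeff_single,
      Polynomial.coeff_monomial]
    grind

theorem mem_lattM_iff (Fq : Type) [Field Fq] {d : ℕ} (n : Fin d → ℤ)
    (v : Fin d → LaurentSeries Fq) :
    v ∈ lattM Fq n ↔ ∀ i, ∀ k < -n i, (v i).coeff k = 0 := by
  rw [lattM, Submodule.mem_span_range_iff_exists_fun]
  have key : ∀ (c : Fin d → PowerSeries Fq) (i : Fin d),
      (∑ j, c j • ((HahnSeries.single (-(n j)) (1 : Fq) : LaurentSeries Fq) •
        (Pi.single j (1 : LaurentSeries Fq) : Fin d → LaurentSeries Fq))) i =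
      HahnSeries.single (-(n i)) (1 : Fq) * (c i : LaurentSeries Fq) := by
    intro c i
    rw [Finset.sum_apply, Finset.sum_eq_single i]
    · simp [Algebra.smul_def, mul_comm]
    · intro j _ hj
      simp [Pi.single_eq_of_ne hj.symm]
    · simp
  constructor
  · rintro ⟨c, rfl⟩ i k hk
    rw [key, HahnSeries.coeff_single_mul, one_mul, PowerSeries.coeff_coe, if_pos (by lia)]
  · intro h
    refine ⟨fun i => PowerSeries.mk fun m => (v i).coeff (m - n i), ?_⟩
    funext i
    rw [key]
    ext k
    rw [HahnSeries.coeff_single_mul, one_mul, PowerSeries.coeff_coe]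
    split_ifs with hk
    · exact (h i k (by lia)).symm
    · rw [PowerSeries.coeff_mk]
      congr 1
      lia

theorem actM_le_iff (Fq : Type) [Field Fq] {d : ℕ} (n : Fin d → ℤ)
    (γ : GL (Fin d) (Polynomial Fq)) :
    actM Fq (glToF Fq γ) (lattM Fq n) ≤ lattM Fq n ↔
      ∀ i j, (γ : Matrix (Fin d) (Fin d) (Polynomial Fq)) i j ∈
        degreeLT Fq (n i - n j + 1).toNat := by
  conv_lhs => rw [actM, lattM, Submodule.map_span_le]
  rw [Set.forall_mem_range, forall_comm]
  refine forall_congr' fun j => ?_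
  change _ ∈ lattM Fq n ↔ _
  rw [mem_lattM_iff]
  refine forall_congr' fun i => ?_
  have : ((glToF Fq γ).mulVecLin.restrictScalars (PowerSeries Fq)
      ((HahnSeries.single (-(n j)) (1 : Fq) : LaurentSeries Fq) •
        (Pi.single j (1 : LaurentSeries Fq) : Fin d → LaurentSeries Fq))) i =
      HahnSeries.single (-(n j)) (1 : Fq) * polyToF Fq (γ.1 i j) := by
    simp [glToF]
  rw [this, Polynomial.mem_degreeLT, Polynomial.degree_lt_iff_coeff_zero]
  simp only [HahnSeries.coeff_single_mul, coeff_polyToF, one_mul]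
  constructor
  · intro h m hm
    have := h (-n j - m) (by lia)
    rwa [if_pos (by lia), show (-n j - (m : ℤ) - -n j).natAbs = m by lia] at this
  · intro h k hk
    split_ifs
    · exact h _ (by lia)
    · rfl

theorem actM_mul (Fq : Type) [Field Fq] {d : ℕ} (γ δ : GL (Fin d) (Polynomial Fq))
    (L : Submodule (PowerSeries Fq) (Fin d → LaurentSeries Fq)) :
    actM Fq (glToF Fq (γ * δ)) L = actM Fq (glToF Fq γ) (actM Fq (glToF Fq δ) L) := by
  rw [actM, actM, actM, ← Submodule.map_comp]
  congr 1
  ext v : 1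
  simp [glToF, Matrix.map_mul]

theorem actM_one (Fq : Type) [Field Fq] {d : ℕ}
    (L : Submodule (PowerSeries Fq) (Fin d → LaurentSeries Fq)) :
    actM Fq (glToF Fq (1 : GL (Fin d) (Polynomial Fq))) L = L := by
  have : glToF Fq (1 : GL (Fin d) (Polynomial Fq)) = 1 := by
    simp [glToF]
  rw [actM, this, Matrix.mulVecLin_one]
  exact Submodule.map_id L

instance finite_degreeLT (Fq : Type) [Field Fq] [Finite Fq] (m : ℕ) :
    Finite (degreeLT Fq m) :=
  Finite.of_equiv _ (Polynomial.degreeLTEquiv Fq m).toEquiv.symm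

theorem card_degreeLT (Fq : Type) [Field Fq] [Fintype Fq] (m : ℕ) :
    Nat.card (degreeLT Fq m) = Fintype.card Fq ^ m := by
  rw [Nat.card_congr (Polynomial.degreeLTEquiv Fq m).toEquiv]
  simp

/-- The monoid of `γ ∈ GL_d(𝔽_q[t])` with `γ l_n̄ ⊆ l_n̄`. -/
def contractingMonoid (Fq : Type) [Field Fq] {d : ℕ} (n : Fin d → ℤ) :
    Submonoid (GL (Fin d) (Polynomial Fq)) where
  carrier := {γ | actM Fq (glToF Fq γ) (lattM Fq n) ≤ lattM Fq n}
  one_mem' := (actM_one Fq _).le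
  mul_mem' {γ δ} hγ hδ := by
    change actM _ _ _ ≤ _
    rw [actM_mul]
    exact (Submodule.map_mono hδ).trans hγ

instance finite_contractingMonoid (Fq : Type) [Field Fq] [Finite Fq] {d : ℕ} (n : Fin d → ℤ) :
    Finite (contractingMonoid Fq n) := by
  refine Finite.of_injective (β := ∀ i j : Fin d, degreeLT Fq (n i - n j + 1).toNat)
    (fun γ i j => ⟨γ.1.1 i j, (actM_le_iff Fq n γ.1).1 γ.2 i j⟩) ?_
  intro γ δ h
  refine Subtype.ext (Units.ext (Matrix.ext fun i j => ?_))
  exact congrArg Subtype.val (congrFun (congrFun h i) j)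

theorem mem_Stab_iff (Fq : Type) [Field Fq] [Finite Fq] {d : ℕ} (n : Fin d → ℤ)
    (γ : GL (Fin d) (Polynomial Fq)) :
    γ ∈ Stab Fq n ↔ ∀ i j, (γ : Matrix (Fin d) (Fin d) (Polynomial Fq)) i j ∈
        degreeLT Fq (n i - n j + 1).toNat := by
  rw [← actM_le_iff]
  refine ⟨fun h => le_of_eq h, fun h => le_antisymm h ?_⟩
  have hfin : IsOfFinOrder γ := by
    by_contra hγ
    exact not_injective_infinite_finite
      (fun k : ℕ => (⟨γ ^ k, pow_mem (S := contractingMonoid Fq n) h k⟩ : contractingMonoid Fq n))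
      fun k l hkl => injective_pow_iff_not_isOfFinOrder.2 hγ (congrArg Subtype.val hkl)
  have hinv : γ⁻¹ ∈ contractingMonoid Fq n := by
    have : γ⁻¹ ∈ Submonoid.powers γ :=
      hfin.mem_powers_iff_mem_zpowers.2 (inv_mem (Subgroup.mem_zpowers γ))
    exact (Submonoid.powers_le (P := contractingMonoid Fq n)).2 h this
  calc lattM Fq n = actM Fq (glToF Fq γ) (actM Fq (glToF Fq γ⁻¹) (lattM Fq n)) := by
        rw [← actM_mul, mul_inv_cancel, actM_one]
    _ ≤ _ := Submodule.map_mono hinv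

theorem card_Stab_eq_of_range (Fq : Type) [Field Fq] [Finite Fq] {d : ℕ} (n : Fin d → ℤ)
    {X : Type*} (f : X → Matrix (Fin d) (Fin d) (Polynomial Fq)) (hf : Function.Injective f)
    (hrange : ∀ M, M ∈ Set.range f ↔
      (∀ i j, M i j ∈ degreeLT Fq (n i - n j + 1).toNat) ∧ IsUnit M.det) :
    Nat.card (Stab Fq n) = Nat.card X := by
  rw [Nat.card_congr (Equiv.ofInjective f hf)]
  refine Nat.card_congr (Equiv.ofBijective
    (fun γ => ⟨γ.1.1, (hrange _).2 ⟨(mem_Stab_iff Fq n γ.1).1 γ.2,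
      (Matrix.isUnit_iff_isUnit_det _).1 γ.1.isUnit⟩⟩) ⟨fun γ δ h => ?_, fun M => ?_⟩)
  · exact Subtype.ext (Units.ext (congrArg Subtype.val h))
  · obtain ⟨hM, hu⟩ := (hrange _).1 M.2
    obtain ⟨γ, hγ⟩ := (Matrix.isUnit_iff_isUnit_det _).2 hu
    exact ⟨⟨γ, (mem_Stab_iff Fq n γ).2 (by rwa [hγ])⟩, Subtype.ext hγ⟩

theorem mem_degreeLT_one_iff {R : Type*} [CommRing R] (p : Polynomial R) :
    p ∈ degreeLT R 1 ↔ ∃ a, p = C a := by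
  rw [Polynomial.mem_degreeLT, Polynomial.degree_lt_iff_coeff_zero]
  constructor
  · intro h
    refine ⟨p.coeff 0, Polynomial.ext fun m => ?_⟩
    rcases m with _ | m
    · simp
    · simp [h]
  · rintro ⟨a, rfl⟩ m hm
    rw [Polynomial.coeff_C, if_neg (by lia)]

theorem degreeLT_zero {R : Type*} [CommRing R] : degreeLT R 0 = ⊥ := by
  rw [eq_bot_iff]
  intro p hp
  rw [Polynomial.mem_degreeLT] at hp
  simpa using hp

theorem card_GL_two (Fq : Type) [Field Fq] [Fintype Fq] :
    Nat.card (GL (Fin 2) Fq) =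
      (Fintype.card Fq - 1) ^ 2 * Fintype.card Fq * (Fintype.card Fq + 1) := by
  rw [Matrix.card_GL_field]
  obtain ⟨k, hk⟩ : ∃ k, Fintype.card Fq = k + 1 := ⟨_, (Nat.sub_add_cancel Fintype.card_pos).symm⟩
  simp only [Fin.prod_univ_two, hk, Fin.val_zero, Fin.val_one, Nat.add_sub_cancel]
  rw [Nat.sub_eq_of_eq_add (c := k * (k + 2)) (by ring),
    Nat.sub_eq_of_eq_add (c := k * (k + 1)) (by ring)]
  ring

theorem card_GL_three (Fq : Type) [Field Fq] [Fintype Fq] :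
    Nat.card (GL (Fin 3) Fq) =
      (Fintype.card Fq - 1) ^ 3 * Fintype.card Fq ^ 3 * (Fintype.card Fq + 1) *
        (Fintype.card Fq ^ 2 + Fintype.card Fq + 1) := by
  rw [Matrix.card_GL_field]
  obtain ⟨k, hk⟩ : ∃ k, Fintype.card Fq = k + 1 := ⟨_, (Nat.sub_add_cancel Fintype.card_pos).symm⟩
  simp only [Fin.prod_univ_three, hk, Fin.val_zero, Fin.val_one, Fin.val_two, Nat.add_sub_cancel]
  rw [Nat.sub_eq_of_eq_add (c := k * ((k + 1) ^ 2 + (k + 1) + 1)) (by ring),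
    Nat.sub_eq_of_eq_add (c := k * (k + 1) * (k + 2)) (by ring),
    Nat.sub_eq_of_eq_add (c := k * (k + 1) ^ 2) (by ring)]
  ring

theorem card_Stab_zero (Fq : Type) [Field Fq] [Finite Fq] :
    Nat.card (Stab Fq (![0, 0, 0] : Fin 3 → ℤ)) = Nat.card (GL (Fin 3) Fq) := by
  refine card_Stab_eq_of_range Fq _ (fun g => g.1.map C) ?_ ?_
  · intro g h hgh
    exact Units.ext (Matrix.map_injective Polynomial.C_injective hgh)
  · intro M
    have h0 : (![0, 0, 0] : Fin 3 → ℤ) = 0 := by simp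
    simp only [h0, Pi.zero_apply, sub_zero, zero_add, Int.toNat_one, mem_degreeLT_one_iff]
    constructor
    · rintro ⟨g, rfl⟩
      refine ⟨fun i j => ⟨_, rfl⟩, ?_⟩
      change IsUnit (C.mapMatrix g.1).det
      rw [← RingHom.map_det]
      exact ((Matrix.isUnit_iff_isUnit_det _).1 g.isUnit).map C
    · rintro ⟨hM, hu⟩
      choose A hA using hM
      have hMA : M = C.mapMatrix (Matrix.of A) := Matrix.ext fun i j => hA i j
      rw [hMA, ← RingHom.map_det, Polynomial.isUnit_C] at hu
      obtain ⟨g, hg⟩ := (Matrix.isUnit_iff_isUnit_det _).2 hu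
      exact ⟨g, by rw [hMA, ← hg]; rfl⟩

theorem card_Stab_two_one (Fq : Type) [Field Fq] [Fintype Fq] (n : ℕ) (hn : 1 ≤ n) :
    Nat.card (Stab Fq (![(n : ℤ), (n : ℤ), 0] : Fin 3 → ℤ)) =
      Nat.card (GL (Fin 2) Fq × Fqˣ × degreeLT Fq (n + 1) × degreeLT Fq (n + 1)) := by
  refine card_Stab_eq_of_range Fq _ (fun x => !![C (x.1.1 0 0), C (x.1.1 0 1), x.2.2.1.1;
    C (x.1.1 1 0), C (x.1.1 1 1), x.2.2.2.1; 0, 0, C x.2.1.1]) ?_ ?_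
  · rintro ⟨g, u, p, r⟩ ⟨g', u', p', r'⟩ h
    have h' := fun i j => congrFun (congrFun h i) j
    simp [Fin.forall_fin_succ] at h'
    simp only [Prod.mk.injEq, Units.ext_iff, Subtype.ext_iff]
    refine ⟨?_, by tauto, by tauto, by tauto⟩
    ext i j
    fin_cases i <;> fin_cases j <;> simp <;> tauto
  · intro M
    have e1 : (-(n : ℤ) + 1).toNat = 0 := by lia
    have e2 : ((n : ℤ) + 1).toNat = n + 1 := by lia
    simp [Fin.forall_fin_succ, e1, e2, mem_degreeLT_one_iff, degreeLT_zero]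
    constructor
    · rintro ⟨g, u, p, hp, r, hr, rfl⟩
      refine ⟨by simp [hp, hr], ?_⟩
      rw [show Matrix.det
          !![C (g.1 0 0), C (g.1 0 1), p; C (g.1 1 0), C (g.1 1 1), r; 0, 0, C (u : Fq)] =
          C (g.1.det * u) by
        rw [Matrix.det_fin_three, Matrix.det_fin_two]; simp; ring, Polynomial.isUnit_C]
      exact ((Matrix.isUnit_iff_isUnit_det _).1 g.isUnit).mul u.isUnit
    · rintro ⟨⟨⟨⟨a, ha⟩, ⟨b, hb⟩, hp⟩, ⟨⟨c, hc⟩, ⟨d, hd⟩, hr⟩, h20, h21, ⟨u, hu⟩⟩, hM⟩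
      have hMeq : M = !![C a, C b, M 0 2; C c, C d, M 1 2; 0, 0, C u] := by
        ext1 i j
        fin_cases i <;> fin_cases j <;> simp [*]
      have hdet : M.det = C ((!![a, b; c, d] : Matrix (Fin 2) (Fin 2) Fq).det * u) := by
        rw [hMeq, Matrix.det_fin_three, Matrix.det_fin_two]
        simp
        ring
      rw [hdet, Polynomial.isUnit_C, IsUnit.mul_iff] at hM
      obtain ⟨g, hg⟩ := (Matrix.isUnit_iff_isUnit_det _).2 hM.1
      obtain ⟨v, rfl⟩ := hM.2
      refine ⟨g, v, _, hp, _, hr, ?_⟩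
      rw [hMeq, hg]
      simp

theorem card_Stab_one_two (Fq : Type) [Field Fq] [Fintype Fq] (n : ℕ) (hn : 1 ≤ n) :
    Nat.card (Stab Fq (![(n : ℤ), 0, 0] : Fin 3 → ℤ)) =
      Nat.card (GL (Fin 2) Fq × Fqˣ × degreeLT Fq (n + 1) × degreeLT Fq (n + 1)) := by
  refine card_Stab_eq_of_range Fq _ (fun x => !![C x.2.1.1, x.2.2.1.1, x.2.2.2.1;
    0, C (x.1.1 0 0), C (x.1.1 0 1); 0, C (x.1.1 1 0), C (x.1.1 1 1)]) ?_ ?_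
  · rintro ⟨g, u, p, r⟩ ⟨g', u', p', r'⟩ h
    have h' := fun i j => congrFun (congrFun h i) j
    simp [Fin.forall_fin_succ] at h'
    simp only [Prod.mk.injEq, Units.ext_iff, Subtype.ext_iff]
    refine ⟨?_, by tauto, by tauto, by tauto⟩
    ext i j
    fin_cases i <;> fin_cases j <;> simp <;> tauto
  · intro M
    have e1 : (-(n : ℤ) + 1).toNat = 0 := by lia
    have e2 : ((n : ℤ) + 1).toNat = n + 1 := by lia
    simp [Fin.forall_fin_succ, e1, e2, mem_degreeLT_one_iff, degreeLT_zero]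
    constructor
    · rintro ⟨g, u, p, hp, r, hr, rfl⟩
      refine ⟨by simp [hp, hr], ?_⟩
      rw [show Matrix.det
          !![C (u : Fq), p, r; 0, C (g.1 0 0), C (g.1 0 1); 0, C (g.1 1 0), C (g.1 1 1)] =
          C (g.1.det * u) by
        rw [Matrix.det_fin_three, Matrix.det_fin_two]; simp; ring, Polynomial.isUnit_C]
      exact ((Matrix.isUnit_iff_isUnit_det _).1 g.isUnit).mul u.isUnit
    · rintro ⟨⟨⟨⟨u, hu⟩, hp, hr⟩, ⟨h10, ⟨a, ha⟩, ⟨b, hb⟩⟩, h20, ⟨c, hc⟩, ⟨d, hd⟩⟩, hM⟩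
      have hMeq : M = !![C u, M 0 1, M 0 2; 0, C a, C b; 0, C c, C d] := by
        ext1 i j
        fin_cases i <;> fin_cases j <;> simp [*]
      have hdet : M.det = C ((!![a, b; c, d] : Matrix (Fin 2) (Fin 2) Fq).det * u) := by
        rw [hMeq, Matrix.det_fin_three, Matrix.det_fin_two]
        simp
        ring
      rw [hdet, Polynomial.isUnit_C, IsUnit.mul_iff] at hM
      obtain ⟨g, hg⟩ := (Matrix.isUnit_iff_isUnit_det _).2 hM.1
      obtain ⟨v, rfl⟩ := hM.2
      refine ⟨g, v, _, hp, _, hr, ?_⟩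
      rw [hMeq, hg]
      simp

theorem card_Stab_one_one_one (Fq : Type) [Field Fq] [Fintype Fq] (n₁ n₂ : ℕ) (h₂ : 1 ≤ n₂)
    (h₁ : n₂ < n₁) :
    Nat.card (Stab Fq (![(n₁ : ℤ), (n₂ : ℤ), 0] : Fin 3 → ℤ)) =
      Nat.card (Fqˣ × Fqˣ × Fqˣ × degreeLT Fq (n₁ - n₂ + 1) × degreeLT Fq (n₁ + 1) ×
        degreeLT Fq (n₂ + 1)) := by
  refine card_Stab_eq_of_range Fq _ (fun x => !![C x.1.1, x.2.2.2.1.1, x.2.2.2.2.1.1;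
    0, C x.2.1.1, x.2.2.2.2.2.1; 0, 0, C x.2.2.1.1]) ?_ ?_
  · rintro ⟨u, v, w, p, r, s⟩ ⟨u', v', w', p', r', s'⟩ h
    have h' := fun i j => congrFun (congrFun h i) j
    simp [Fin.forall_fin_succ] at h'
    simp only [Prod.mk.injEq, Units.ext_iff, Subtype.ext_iff]
    tauto
  · intro M
    have e1 : (-(n₁ : ℤ) + 1).toNat = 0 := by lia
    have e2 : ((n₁ : ℤ) + 1).toNat = n₁ + 1 := by lia
    have e3 : (-(n₂ : ℤ) + 1).toNat = 0 := by lia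
    have e4 : ((n₂ : ℤ) + 1).toNat = n₂ + 1 := by lia
    have e5 : ((n₁ : ℤ) - n₂ + 1).toNat = n₁ - n₂ + 1 := by lia
    have e6 : ((n₂ : ℤ) - n₁ + 1).toNat = 0 := by lia
    simp [Fin.forall_fin_succ, e1, e2, e3, e4, e5, e6, mem_degreeLT_one_iff, degreeLT_zero]
    constructor
    · rintro ⟨u, v, w, p, hp, r, hr, s, hs, rfl⟩
      refine ⟨by simp [hp, hr, hs], ?_⟩
      simp [Matrix.det_fin_three]
    · rintro ⟨⟨⟨⟨a, ha⟩, hp, hr⟩, ⟨h10, ⟨b, hb⟩, hs⟩, h20, h21, ⟨c, hc⟩⟩, hM⟩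
      have hMeq : M = !![C a, M 0 1, M 0 2; 0, C b, M 1 2; 0, 0, C c] := by
        ext1 i j
        fin_cases i <;> fin_cases j <;> simp [*]
      have hdet : M.det = C (a * b * c) := by
        rw [hMeq, Matrix.det_fin_three]
        simp
      rw [hdet, Polynomial.isUnit_C, IsUnit.mul_iff, IsUnit.mul_iff] at hM
      obtain ⟨⟨⟨u, rfl⟩, ⟨v, rfl⟩⟩, ⟨w, rfl⟩⟩ := hM
      exact ⟨u, v, w, _, hp, _, hr, _, hs, hMeq.symm⟩

open Matrix Polynomial in
/-- the stabilizer cardinalities for `d = 3`: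
`|S_{(0,0,0)}| = |GL₃(𝔽_q)| = (q-1)³q³(q+1)(q²+q+1)`,
`|S_{(n,n,0)}| = |S_{(n,0,0)}| = (q-1)³(q+1)q^{2n+3}` for `n ≥ 1`, and
`|S_{(n₁,n₂,0)}| = (q-1)³q^{2n₁+3}` for `n₁ > n₂ ≥ 1`. -/
theorem card_stabilizer_dim_three (Fq : Type) [Field Fq] [Fintype Fq]
    (q : ℕ) (hq : q = Fintype.card Fq) :
    (Nat.card (Stab Fq (![0, 0, 0] : Fin 3 → ℤ)) = Nat.card (GL (Fin 3) Fq) ∧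
      Nat.card (GL (Fin 3) Fq) = (q - 1) ^ 3 * q ^ 3 * (q + 1) * (q ^ 2 + q + 1)) ∧
    (∀ n : ℕ, 1 ≤ n →
      Nat.card (Stab Fq (![(n : ℤ), (n : ℤ), 0] : Fin 3 → ℤ)) =
          (q - 1) ^ 3 * (q + 1) * q ^ (2 * n + 3) ∧
      Nat.card (Stab Fq (![(n : ℤ), 0, 0] : Fin 3 → ℤ)) =
          (q - 1) ^ 3 * (q + 1) * q ^ (2 * n + 3)) ∧
    (∀ n₁ n₂ : ℕ, 1 ≤ n₂ → n₂ < n₁ →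
      Nat.card (Stab Fq (![(n₁ : ℤ), (n₂ : ℤ), 0] : Fin 3 → ℤ)) =
          (q - 1) ^ 3 * q ^ (2 * n₁ + 3)) := by
  subst hq
  refine ⟨⟨card_Stab_zero Fq, card_GL_three Fq⟩, fun n hn => ⟨?_, ?_⟩, fun n₁ n₂ h₂ h₁ => ?_⟩
  · rw [card_Stab_two_one Fq n hn]
    simp only [Nat.card_prod, card_GL_two, card_degreeLT, Nat.card_units, Nat.card_eq_fintype_card]
    ring
  · rw [card_Stab_one_two Fq n hn]
    simp only [Nat.card_prod, card_GL_two, card_degreeLT, Nat.card_units, Nat.card_eq_fintype_card]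
    ring
  · rw [card_Stab_one_one_one Fq n₁ n₂ h₂ h₁]
    obtain ⟨k, rfl⟩ := Nat.exists_eq_add_of_lt h₁
    simp only [Nat.card_prod, card_degreeLT, Nat.card_units, Nat.card_eq_fintype_card]
    rw [show n₂ + k + 1 - n₂ = k + 1 by lia]
    ring
end

section
/- On the set of $\mathcal{O}$-lattices in $F^d$ (finitely generated $\mathcal{O}$-submodules spanning $F^d$ over $F$), define the equivalence relation $L \sim L'$ iff there exist $\gamma \in GL_d(\mathbb{F}_q[t])$ and $a \in F^{\times}$ with $L' = a\,\gamma L$. Then the map sending $\bar{n} \in N_T^d$ to the equivalence class of $l_{\bar{n}}$ is a bijection from $N_T^d$ onto the set of equivalence classes. (That is, $T$ is a fundamental domain for the action of the non-uniform lattice $PGL_d(\mathbb{F}_q[t])$ on the vertices of the Bruhat–Tits building of $PGL_d(F)$.) -/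
open Matrix Polynomial

noncomputable section

variable {K : Type} [Field K] {d : ℕ}

/-- The `𝒪`-span of the columns of a matrix. -/
def colSpan (A : Matrix (Fin d) (Fin d) (LaurentSeries K)) :
    Submodule (PowerSeries K) (Fin d → LaurentSeries K) :=
  Submodule.span (PowerSeries K) (Set.range fun j i => A i j)

/-- The diagonal matrix `diag(t^{n₁}, …, t^{n_d})`. -/
def diagT (K : Type) [Field K] (n : Fin d → ℤ) : Matrix (Fin d) (Fin d) (LaurentSeries K) :=
  Matrix.diagonal fun i => HahnSeries.single (-(n i)) 1

/-- A matrix over `𝒪`, viewed over `F`. -/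
def intMat (P : Matrix (Fin d) (Fin d) (PowerSeries K)) :
    Matrix (Fin d) (Fin d) (LaurentSeries K) :=
  P.map (algebraMap (PowerSeries K) (LaurentSeries K))

theorem lattM_eq_colSpan (n : Fin d → ℤ) : lattM K n = colSpan (diagT K n) := by
  unfold lattM colSpan
  congr 2
  ext j i : 2
  by_cases h : i = j
  · subst h; simp [diagT]
  · simp [diagT, h]

theorem actM_colSpan (g A : Matrix (Fin d) (Fin d) (LaurentSeries K)) :
    actM K g (colSpan A) = colSpan (g * A) := by
  unfold actM colSpan
  rw [Submodule.map_span, ← Set.range_comp]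
  rfl

theorem scaleM_colSpan (a : LaurentSeries K) (A : Matrix (Fin d) (Fin d) (LaurentSeries K)) :
    scaleM K a (colSpan A) = colSpan (a • A) := by
  unfold scaleM colSpan
  rw [Submodule.map_span, ← Set.range_comp]
  rfl

theorem colSpan_le_iff {A B : Matrix (Fin d) (Fin d) (LaurentSeries K)} :
    colSpan A ≤ colSpan B ↔ ∃ P : Matrix (Fin d) (Fin d) (PowerSeries K), A = B * intMat P := by
  have key : ∀ (c : Fin d → PowerSeries K) (i : Fin d),
      (∑ k, c k • (fun i => B i k)) i = ∑ k, B i k * algebraMap _ (LaurentSeries K) (c k) := by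
    intro c i
    simp [Finset.sum_apply, Algebra.smul_def, mul_comm]
  unfold colSpan
  rw [Submodule.span_le, Set.range_subset_iff]
  simp only [SetLike.mem_coe, Submodule.mem_span_range_iff_exists_fun]
  constructor
  · intro h
    choose c hc using h
    refine ⟨Matrix.of fun k j => c j k, ?_⟩
    ext1 i j
    rw [← congrFun (hc j) i, key]
    simp [Matrix.mul_apply, intMat]
  · rintro ⟨P, rfl⟩ j
    refine ⟨fun k => P k j, ?_⟩
    ext1 i
    rw [key]
    simp [Matrix.mul_apply, intMat]

theorem colSpan_mul_intMat (A : Matrix (Fin d) (Fin d) (LaurentSeries K))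
    {P : Matrix (Fin d) (Fin d) (PowerSeries K)} (hP : IsUnit P.det) :
    colSpan (A * intMat P) = colSpan A := by
  apply le_antisymm (colSpan_le_iff.2 ⟨P, rfl⟩)
  refine colSpan_le_iff.2 ⟨P⁻¹, ?_⟩
  unfold intMat
  rw [Matrix.mul_assoc, ← Matrix.map_mul, Matrix.mul_nonsing_inv _ hP]
  simp

theorem colSpan_submatrix (A : Matrix (Fin d) (Fin d) (LaurentSeries K))
    (σ : Equiv.Perm (Fin d)) : colSpan (A.submatrix id σ) = colSpan A := by
  unfold colSpan
  congr 1
  exact σ.surjective.range_comp fun j i => A i j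

theorem polyToF_monomial (k : ℕ) (c : K) :
    polyToF K (C c * X ^ k) = HahnSeries.single (-(k : ℤ)) c := by
  have h (k : ℕ) : (tF K) ^ k = HahnSeries.single (-(k : ℤ)) 1 := by
    rw [tF, HahnSeries.single_pow]; simp
  simp [polyToF, h, HahnSeries.C_apply, HahnSeries.single_mul_single]

theorem coeff_polyToF_s9 (p : K[X]) (k : ℕ) : (polyToF K p).coeff (-(k : ℤ)) = p.coeff k := by
  induction p using Polynomial.induction_on' with
  | add p q hp hq => simp [hp, hq]
  | monomial n c =>
    rw [← C_mul_X_pow_eq_monomial, polyToF_monomial, HahnSeries.coeff_single]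
    simp [coeff_X_pow]

theorem polyToF_ne_zero {p : K[X]} (hp : p ≠ 0) : polyToF K p ≠ 0 := by
  intro h
  apply hp
  ext k
  rw [← coeff_polyToF_s9, h]
  simp

theorem order_polyToF_nonpos {p : K[X]} (hp : p ≠ 0) : (polyToF K p).order ≤ 0 := by
  have h : (polyToF K p).coeff (-(p.natDegree : ℤ)) ≠ 0 := by
    rw [coeff_polyToF_s9]
    simpa using hp
  have := HahnSeries.order_le_of_coeff_ne_zero h
  omega

theorem order_algebraMap_nonneg (p : PowerSeries K) :
    0 ≤ (algebraMap (PowerSeries K) (LaurentSeries K) p).order := by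
  by_cases hp : algebraMap (PowerSeries K) (LaurentSeries K) p = 0
  · simp [hp]
  by_contra! h
  apply HahnSeries.coeff_order_eq_zero.not.2 hp
  rw [LaurentSeries.coe_algebraMap] at h ⊢
  rw [PowerSeries.coeff_coe, if_pos h]

theorem exists_algebraMap_of_order {f : LaurentSeries K} (hf : 0 ≤ f.order) :
    ∃ p, algebraMap (PowerSeries K) (LaurentSeries K) p = f := by
  obtain ⟨k, hk⟩ := Int.eq_ofNat_of_zero_le hf
  refine ⟨PowerSeries.X ^ k * f.powerSeriesPart, ?_⟩
  exact LaurentSeries.X_order_mul_powerSeriesPart hk.symm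

theorem exists_perm_apply_ne_zero {R : Type*} [CommRing R] {A : Matrix (Fin d) (Fin d) R}
    (h : A.det ≠ 0) : ∃ σ : Equiv.Perm (Fin d), ∀ i, A (σ i) i ≠ 0 := by
  contrapose! h
  rw [Matrix.det_apply]
  refine Finset.sum_eq_zero fun σ _ => ?_
  obtain ⟨i, hi⟩ := h σ
  have : ∏ i, A (σ i) i = 0 := Finset.prod_eq_zero (Finset.mem_univ i) hi
  rw [this, smul_zero]

theorem le_of_perm_le {n m : Fin d → ℤ} (hn : Antitone n) (hm : Antitone m)
    (σ : Equiv.Perm (Fin d)) (h : ∀ j, n j ≤ m (σ j)) : n ≤ m := by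
  intro i
  obtain ⟨j, hj, hij⟩ : ∃ j ≤ i, i ≤ σ j := by
    by_contra! hc
    have hcard : (Finset.Iic i).card ≤ (Finset.Iio i).card :=
      Finset.card_le_card_of_injOn σ (by simpa [Set.MapsTo] using hc) σ.injective.injOn
    simp at hcard
  exact (hn hj).trans ((h j).trans (hm hij))

theorem sub_order_le_of_smul_mul_diagT_eq {M : Matrix (Fin d) (Fin d) K[X]} (hM : M.det ≠ 0)
    {a : LaurentSeries K} (ha : a ≠ 0) {n m : Fin d → ℤ} (hn : Antitone n) (hm : Antitone m)
    {Q : Matrix (Fin d) (Fin d) (PowerSeries K)}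
    (h : a • (M.map (polyToF K) * diagT K n) = diagT K m * intMat Q) (i : Fin d) :
    n i - a.order ≤ m i := by
  obtain ⟨σ, hσ⟩ := exists_perm_apply_ne_zero hM
  refine le_of_perm_le (n := fun i => n i - a.order) (fun i j hij => ?_) hm σ (fun j => ?_) i
  · simpa using hn hij
  have hp := polyToF_ne_zero (hσ j)
  have hs (k : ℤ) : (HahnSeries.single k (1 : K) : LaurentSeries K) ≠ 0 := by simp
  have e := congrFun (congrFun h (σ j)) j
  simp only [Matrix.smul_apply, diagT, Matrix.mul_diagonal, Matrix.diagonal_mul, Matrix.map_apply,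
    smul_eq_mul, intMat] at e
  have hQ : algebraMap (PowerSeries K) (LaurentSeries K) (Q (σ j) j) ≠ 0 := by
    intro h0
    rw [h0, mul_zero] at e
    exact mul_ne_zero ha (mul_ne_zero hp (hs _)) e
  have e' := congrArg HahnSeries.order e
  rw [HahnSeries.order_mul ha (mul_ne_zero hp (hs _)), HahnSeries.order_mul hp (hs _),
    HahnSeries.order_mul (hs _) hQ, HahnSeries.order_single one_ne_zero,
    HahnSeries.order_single one_ne_zero] at e'
  have := order_polyToF_nonpos (hσ j)
  have := order_algebraMap_nonneg (Q (σ j) j)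
  omega

theorem det_diagT (n : Fin d → ℤ) : (diagT K n).det = HahnSeries.single (-∑ i, n i) 1 := by
  rw [diagT, Matrix.det_diagonal]
  have (s : Finset (Fin d)) : ∏ i ∈ s, (HahnSeries.single (-(n i)) 1 : LaurentSeries K) =
      HahnSeries.single (-∑ i ∈ s, n i) 1 := by
    induction s using Finset.cons_induction with
    | empty => simp
    | cons a s ha ih =>
      rw [Finset.prod_cons, ih, Finset.sum_cons, HahnSeries.single_mul_single, neg_add, one_mul]
  exact this _

theorem sum_le_of_mul_diagT_eq {g : Matrix (Fin d) (Fin d) (LaurentSeries K)} (hg : g.det ≠ 0)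
    {M : Matrix (Fin d) (Fin d) K[X]} (hM : M.det ≠ 0) {n : Fin d → ℤ}
    {P : Matrix (Fin d) (Fin d) (PowerSeries K)}
    (h : M.map (polyToF K) * diagT K n = g * intMat P) : ∑ i, n i ≤ -g.det.order := by
  have e := congrArg Matrix.det h
  have hp := polyToF_ne_zero hM
  have hs (k : ℤ) : (HahnSeries.single k (1 : K) : LaurentSeries K) ≠ 0 := by simp
  rw [Matrix.det_mul, Matrix.det_mul, det_diagT, ← RingHom.mapMatrix_apply, ← RingHom.map_det,
    intMat, ← RingHom.mapMatrix_apply, ← RingHom.map_det] at e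
  have hQ : algebraMap (PowerSeries K) (LaurentSeries K) P.det ≠ 0 := by
    intro h0
    rw [h0, mul_zero] at e
    exact mul_ne_zero hp (hs _) e
  have e' := congrArg HahnSeries.order e
  rw [HahnSeries.order_mul hp (hs _), HahnSeries.order_mul hg hQ,
    HahnSeries.order_single one_ne_zero] at e'
  have := order_polyToF_nonpos hM
  have := order_algebraMap_nonneg P.det
  omega

theorem exists_diagT_eq_mul_intMat {g : Matrix (Fin d) (Fin d) (LaurentSeries K)}
    (hg : IsUnit g.det) : ∃ (n : Fin d → ℤ) (P : Matrix (Fin d) (Fin d) (PowerSeries K)),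
      diagT K n = g * intMat P := by
  obtain ⟨N, hN⟩ : ∃ N : ℤ, ∀ i j, N ≤ (g⁻¹ i j).order := by
    obtain ⟨N, hN⟩ := (Set.finite_range fun x : Fin d × Fin d => (g⁻¹ x.1 x.2).order).bddBelow
    exact ⟨N, fun i j => hN ⟨(i, j), rfl⟩⟩
  have : ∀ i j, ∃ p, algebraMap (PowerSeries K) (LaurentSeries K) p =
      g⁻¹ i j * HahnSeries.single (-N) 1 := by
    intro i j
    apply exists_algebraMap_of_order
    by_cases h : g⁻¹ i j = 0
    · simp [h]
    rw [HahnSeries.order_mul h (by simp), HahnSeries.order_single one_ne_zero]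
    have := hN i j
    omega
  choose p hp using this
  refine ⟨fun _ => N, Matrix.of p, ?_⟩
  have h : intMat (Matrix.of p) = g⁻¹ * diagT K fun _ => N := by
    ext1 i j
    rw [diagT, Matrix.mul_diagonal, intMat, Matrix.map_apply, Matrix.of_apply, hp]
  rw [h, Matrix.mul_nonsing_inv_cancel_left _ _ hg]

theorem exists_sum_lt_of_not_isUnit {g : Matrix (Fin d) (Fin d) (LaurentSeries K)}
    {M : Matrix (Fin d) (Fin d) K[X]} (hM : IsUnit M.det) {n : Fin d → ℤ}
    {P : Matrix (Fin d) (Fin d) (PowerSeries K)}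
    (h : M.map (polyToF K) * diagT K n = g * intMat P) (hP : ¬ IsUnit P.det) :
    ∃ (M' : Matrix (Fin d) (Fin d) K[X]) (n' : Fin d → ℤ)
      (P' : Matrix (Fin d) (Fin d) (PowerSeries K)), IsUnit M'.det ∧
      M'.map (polyToF K) * diagT K n' = g * intMat P' ∧ ∑ i, n i < ∑ i, n' i := by
  obtain ⟨c, hc0, hc⟩ : ∃ c, c ≠ 0 ∧ P.map PowerSeries.constantCoeff *ᵥ c = 0 := by
    rw [Matrix.exists_mulVec_eq_zero_iff, ← RingHom.mapMatrix_apply, ← RingHom.map_det]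
    rwa [PowerSeries.isUnit_iff_constantCoeff, isUnit_iff_ne_zero, not_not] at hP
  obtain ⟨i₀, hi₀, hmin⟩ : ∃ i₀, c i₀ ≠ 0 ∧ ∀ i, c i ≠ 0 → n i₀ ≤ n i := by
    classical
    obtain ⟨i, hi⟩ := Function.ne_iff.1 hc0
    obtain ⟨j, hj, hj'⟩ := Finset.exists_min_image (Finset.univ.filter fun i => c i ≠ 0) n
      ⟨i, by simpa using hi⟩
    exact ⟨j, by simpa using hj, fun i hi => hj' i (by simpa using hi)⟩
  have hw : ∀ r, ∃ w, ∑ i, P r i * PowerSeries.C (c i) = PowerSeries.X * w := by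
    intro r
    rw [← dvd_def, PowerSeries.X_dvd_iff]
    simpa [Matrix.mulVec, dotProduct] using congrFun hc r
  choose w hw using hw
  set e : Fin d → K[X] := fun i => C (c i) * X ^ (n i - n i₀).toNat with he
  have he' : ∀ i, polyToF K (e i) * HahnSeries.single (-(n i₀ + 1)) 1 =
      HahnSeries.single (-(n i)) 1 * algebraMap (PowerSeries K) (LaurentSeries K)
        (PowerSeries.C (c i)) * HahnSeries.single (-1) 1 := by
    intro i
    have hC : algebraMap (PowerSeries K) (LaurentSeries K) (PowerSeries.C (c i)) =
        HahnSeries.single 0 (c i) := HahnSeries.ofPowerSeries_C _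
    rw [he, polyToF_monomial, hC]
    simp only [HahnSeries.single_mul_single, one_mul, mul_one]
    by_cases hi : c i = 0
    · simp [hi]
    · have := hmin i hi
      congr 2
      omega
  have hX : algebraMap (PowerSeries K) (LaurentSeries K) PowerSeries.X *
      HahnSeries.single (-1) 1 = 1 := by
    rw [LaurentSeries.coe_algebraMap, HahnSeries.ofPowerSeries_X, HahnSeries.single_mul_single]
    simp
  refine ⟨M.updateCol i₀ (M *ᵥ e), Function.update n i₀ (n i₀ + 1), P.updateCol i₀ w, ?_, ?_, ?_⟩
  · have : M.updateCol i₀ (M *ᵥ e) = M * (1 : Matrix (Fin d) (Fin d) K[X]).updateCol i₀ e := by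
      rw [Matrix.mul_updateCol, Matrix.mul_one]
    rw [this, Matrix.det_mul, ← Matrix.cramer_apply, Matrix.cramer_one]
    refine hM.mul ?_
    simpa [he] using hi₀
  · ext1 r j
    by_cases hj : j = i₀
    · subst hj
      have hr (i) := congrFun (congrFun h r) i
      simp only [diagT, Matrix.mul_diagonal, Matrix.map_apply] at hr
      simp only [diagT, Matrix.mul_diagonal, Matrix.map_apply, Matrix.updateCol_self,
        Function.update_self, Matrix.mulVec, dotProduct, map_sum, map_mul, Finset.sum_mul]
      calc _ = (∑ i, (g * intMat P) r i * algebraMap (PowerSeries K) (LaurentSeries K)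
            (PowerSeries.C (c i))) * HahnSeries.single (-1) 1 := by
            rw [Finset.sum_mul]
            refine Finset.sum_congr rfl fun i _ => ?_
            rw [mul_assoc, he', ← hr]
            ring
        _ = ∑ k, g r k * (algebraMap (PowerSeries K) (LaurentSeries K)
            (∑ i, P k i * PowerSeries.C (c i)) * HahnSeries.single (-1) 1) := by
            simp only [Matrix.mul_apply, intMat, Matrix.map_apply, Finset.sum_mul, map_sum,
              map_mul, Finset.mul_sum]
            rw [Finset.sum_comm]
            simp only [mul_assoc]
        _ = _ := by
            simp only [hw, map_mul, mul_right_comm _ _ (HahnSeries.single (-1) (1 : K)), hX]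
            simp [Matrix.mul_apply, intMat]
    · have := congrFun (congrFun h r) j
      simp only [diagT, Matrix.mul_diagonal, Matrix.map_apply] at this
      simp only [diagT, Matrix.mul_diagonal, Matrix.map_apply, Matrix.updateCol_ne hj,
        Function.update_of_ne hj, this]
      simp [Matrix.mul_apply, intMat, Matrix.updateCol_ne hj]
  · refine Finset.sum_lt_sum (fun i _ => ?_) ⟨i₀, Finset.mem_univ _, by simp⟩
    by_cases hi : i = i₀
    · subst hi; simp
    · simp [hi]

theorem exists_mul_diagT_eq_mul_intMat {g : Matrix (Fin d) (Fin d) (LaurentSeries K)}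
    (hg : g.det ≠ 0) : ∃ (M : Matrix (Fin d) (Fin d) K[X]) (n : Fin d → ℤ)
      (P : Matrix (Fin d) (Fin d) (PowerSeries K)), IsUnit M.det ∧ IsUnit P.det ∧
      M.map (polyToF K) * diagT K n = g * intMat P := by
  obtain ⟨s, ⟨M, n, P, hM, h, hs⟩, hmax⟩ := Int.exists_greatest_of_bdd
    (P := fun s => ∃ (M : Matrix (Fin d) (Fin d) K[X]) (n : Fin d → ℤ)
      (P : Matrix (Fin d) (Fin d) (PowerSeries K)), IsUnit M.det ∧
      M.map (polyToF K) * diagT K n = g * intMat P ∧ ∑ i, n i = s)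
    ⟨-g.det.order, by
      rintro _ ⟨M, n, P, hM, h, rfl⟩
      exact sum_le_of_mul_diagT_eq hg hM.ne_zero h⟩
    (by
      obtain ⟨n, P, h⟩ := exists_diagT_eq_mul_intMat hg.isUnit
      exact ⟨_, 1, n, P, by simp, by simpa using h, rfl⟩)
  refine ⟨M, n, P, hM, ?_, h⟩
  by_contra hP
  obtain ⟨M', n', P', hM', h', hlt⟩ := exists_sum_lt_of_not_isUnit hM h hP
  have := hmax _ ⟨M', n', P', hM', h', rfl⟩
  omega

theorem exists_eq_colSpan (L : Submodule (PowerSeries K) (Fin d → LaurentSeries K)) (hL : L.FG)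
    (hspan : Submodule.span (LaurentSeries K) (L : Set (Fin d → LaurentSeries K)) = ⊤) :
    ∃ g : Matrix (Fin d) (Fin d) (LaurentSeries K), g.det ≠ 0 ∧ L = colSpan g := by
  have : Submodule.IsLattice (LaurentSeries K) L := ⟨hL, hspan⟩
  have : Module.IsTorsionFree (PowerSeries K) (LaurentSeries K) := inferInstance
  have : Module.Free (PowerSeries K) L := Submodule.IsLattice.free (LaurentSeries K) L
  have : Module.Finite (PowerSeries K) L := Submodule.IsLattice.finite (LaurentSeries K) L
  let b := Module.finBasisOfFinrankEq (PowerSeries K) L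
    ((Submodule.IsLattice.finrank_of_pi (LaurentSeries K) L).trans (Fintype.card_fin d))
  refine ⟨(Pi.basisFun (LaurentSeries K) (Fin d)).toMatrix
    (b.extendOfIsLattice (LaurentSeries K)), ?_, ?_⟩
  · exact ((Pi.basisFun (LaurentSeries K) (Fin d)).isUnit_det
      (b.extendOfIsLattice (LaurentSeries K))).ne_zero
  · have h := congrArg (Submodule.map L.subtype) b.span_eq
    rw [Submodule.map_span, ← Set.range_comp, Submodule.map_top, Submodule.range_subtype] at h
    refine h.symm.trans ?_
    unfold colSpan
    congr 2
    ext j i : 2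
    simp [Module.Basis.toMatrix_apply]

theorem exists_antitone_colSpan_eq {g : Matrix (Fin d) (Fin d) (LaurentSeries K)}
    (hg : g.det ≠ 0) : ∃ (M : Matrix (Fin d) (Fin d) K[X]) (n : Fin d → ℤ),
      IsUnit M.det ∧ Antitone n ∧ colSpan g = colSpan (M.map (polyToF K) * diagT K n) := by
  obtain ⟨M, n, P, hM, hP, h⟩ := exists_mul_diagT_eq_mul_intMat hg
  let σ := Tuple.sort fun i => -n i
  refine ⟨M.submatrix id σ, n ∘ σ, ?_, ?_, ?_⟩
  · rw [Matrix.det_permute']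
    refine IsUnit.mul ?_ hM
    exact (Equiv.Perm.sign σ).isUnit.map (Int.castRingHom K[X])
  · intro i j hij
    simpa using Tuple.monotone_sort (fun i => -n i) hij
  · rw [← colSpan_mul_intMat g hP, ← h, ← colSpan_submatrix _ σ]
    congr 1
    ext1 i j
    simp [diagT, Matrix.mul_diagonal]

end

open Matrix Polynomial in
/-- the map `n̄ ↦ [l_n̄]` is a bijection from `N_T^d` onto the set of equivalence
classes of `𝒪`-lattices in `F^d` under `L ∼ L' ↔ ∃ γ ∈ GL_d(𝔽_q[t]), a ∈ F^×, L' = a γ L`: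
it is injective (distinct tuples give inequivalent lattices) and surjective (every lattice is
equivalent to some `l_n̄` with `n̄ ∈ N_T^d`). -/
theorem fundamental_domain_bijection (Fq : Type) [Field Fq] [Fintype Fq]
    (d : ℕ) (hd : 2 ≤ d) :
    (∀ n m : Fin d → ℤ, NT n → NT m →
      (∃ (γ : GL (Fin d) (Polynomial Fq)) (a : LaurentSeries Fq),
        a ≠ 0 ∧ scaleM Fq a (actM Fq (glToF Fq γ) (lattM Fq n)) = lattM Fq m) → n = m) ∧
    (∀ L : Submodule (PowerSeries Fq) (Fin d → LaurentSeries Fq), L.FG →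
      Submodule.span (LaurentSeries Fq) (L : Set (Fin d → LaurentSeries Fq)) = ⊤ →
      ∃ n : Fin d → ℤ, NT n ∧
        ∃ (γ : GL (Fin d) (Polynomial Fq)) (a : LaurentSeries Fq),
          a ≠ 0 ∧ scaleM Fq a (actM Fq (glToF Fq γ) L) = lattM Fq n) := by
  have hinv (γ : GL (Fin d) (Polynomial Fq)) : glToF Fq γ⁻¹ * glToF Fq γ = 1 := by
    unfold glToF
    rw [← Matrix.map_mul, ← Units.val_mul, inv_mul_cancel]
    simp
  have hdet (γ : GL (Fin d) (Polynomial Fq)) :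
      (γ : Matrix (Fin d) (Fin d) (Polynomial Fq)).det ≠ 0 :=
    ((Matrix.isUnit_iff_isUnit_det _).1 γ.isUnit).ne_zero
  constructor
  · rintro n m ⟨hn, hn0⟩ ⟨hm, hm0⟩ ⟨γ, a, ha, h⟩
    rw [lattM_eq_colSpan, lattM_eq_colSpan, actM_colSpan, scaleM_colSpan] at h
    obtain ⟨Q, hQ⟩ := colSpan_le_iff.1 h.le
    obtain ⟨P, hP⟩ := colSpan_le_iff.1 h.ge
    have hP' : a⁻¹ • (glToF Fq γ⁻¹ * diagT Fq m) = diagT Fq n * intMat P := by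
      rw [hP, Matrix.smul_mul, Matrix.mul_smul, smul_smul, inv_mul_cancel₀ ha, one_smul,
        ← Matrix.mul_assoc, ← Matrix.mul_assoc, hinv, Matrix.one_mul]
    have h1 := sub_order_le_of_smul_mul_diagT_eq (hdet γ) ha hn hm hQ
    have h2 := sub_order_le_of_smul_mul_diagT_eq (hdet γ⁻¹) (inv_ne_zero ha) hm hn hP'
    have ho : a.order + a⁻¹.order = 0 := by
      rw [← HahnSeries.order_mul ha (inv_ne_zero ha), mul_inv_cancel₀ ha, HahnSeries.order_one]
    let l : Fin d := ⟨d - 1, by omega⟩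
    have hnl := hn0 l rfl
    have hml := hm0 l rfl
    have h1l := h1 l
    have h2l := h2 l
    ext i
    have h1i := h1 i
    have h2i := h2 i
    omega
  · intro L hL hspan
    obtain ⟨g, hg, rfl⟩ := exists_eq_colSpan L hL hspan
    obtain ⟨M, n, hM, hn, h⟩ := exists_antitone_colSpan_eq hg
    let l : Fin d := ⟨d - 1, by omega⟩
    let γ : GL (Fin d) (Polynomial Fq) := Matrix.nonsingInvUnit M hM
    refine ⟨fun i => n i - n l, ⟨fun i j hij => ?_, fun i hi => ?_⟩, γ⁻¹,
      HahnSeries.single (n l) 1, by simp, ?_⟩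
    · simpa using hn hij
    · have : i = l := Fin.ext hi
      simp [this]
    · have hγ : M.map (polyToF Fq) = glToF Fq γ := rfl
      rw [h, hγ, actM_colSpan, scaleM_colSpan, ← Matrix.mul_assoc, hinv, Matrix.one_mul,
        lattM_eq_colSpan]
      congr 1
      ext1 i j
      by_cases hij : i = j
      · subst hij
        simp [diagT, HahnSeries.single_mul_single, sub_eq_add_neg]
      · simp [diagT, hij]
end
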